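/- arXiv:1805.09309 — 2 statements merged into one kernel-verified Lean document; each statement's English description precedes it below -/
import Mathlib

section
/- Let G and H be finite abelian groups. Then G ≅ H if and only if there exist an integer r ≥ 1 and integers m₁, m₂, ..., m_r, n₁, n₂, ..., n_r, all at least 2, such that gcd(m₁, m₂, ..., m_r) = gcd(n₁, n₂, ..., n_r) and for every i = 1, ..., r the subgroup lattice of G^{mᵢ} is isomorphic (as an order/lattice) to the subgroup lattice of H^{nᵢ}. -/
open Subgroup

section SubgroupLattice

variable {A B : Type*} [CommGroup A] [CommGroup B]

theorem isAtom_zpowers_of_prime_orderOf [Finite A] {x : A} (hx : (orderOf x).Prime) :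
    IsAtom (zpowers x) := by
  refine ⟨?_, fun K hK => ?_⟩
  · rw [Ne, zpowers_eq_bot, ← orderOf_eq_one_iff]
    exact hx.ne_one
  · have hdvd := card_dvd_of_le hK.le
    rw [Nat.card_zpowers] at hdvd
    rcases hx.eq_one_or_self_of_dvd _ hdvd with h | h
    · exact card_eq_one.mp h
    · exact absurd (eq_of_le_of_card_ge hK.le (by rw [Nat.card_zpowers, h])) hK.ne

theorem exists_prime_orderOf_of_isAtom [Finite A] {K : Subgroup A} (hK : IsAtom K) :
    ∃ x, (orderOf x).Prime ∧ K = zpowers x := by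
  have h1 : Nat.card K ≠ 1 := fun h => hK.1 (card_eq_one.mp h)
  obtain ⟨p, hp, hdvd⟩ := Nat.exists_prime_and_dvd h1
  have := Fact.mk hp
  obtain ⟨x, hx⟩ := exists_prime_orderOf_dvd_card' p hdvd
  rw [← Subgroup.orderOf_coe] at hx
  refine ⟨x, hx ▸ hp, ?_⟩
  rcases hK.le_iff.mp (zpowers_le.mpr x.2) with h | h
  · rw [zpowers_eq_bot, ← orderOf_eq_one_iff] at h
    exact absurd (hx.symm.trans h) hp.ne_one
  · exact h.symm

theorem zpowers_inf_eq_bot_of_prime_orderOf [Finite A] {x : A} (hx : (orderOf x).Prime)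
    {K : Subgroup A} (hxK : x ∉ K) : zpowers x ⊓ K = ⊥ :=
  ((isAtom_zpowers_of_prime_orderOf hx).not_le_iff_disjoint.mp
    (mt zpowers_le.mp hxK)).eq_bot

theorem card_compl_zpowers_of_orderOf_eq [Finite A] {x y : A} (hx : (orderOf x).Prime)
    (hy : orderOf y = orderOf x) (hxy : y ∉ zpowers x) :
    Nat.card {C : Subgroup A // C ⊓ zpowers x = ⊥ ∧ C ⊔ zpowers x = zpowers y ⊔ zpowers x} =
      orderOf x := by
  have hmem : ∀ c ∈ zpowers x, c * y ∉ zpowers x := fun c hc h =>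
    hxy ((mul_mem_cancel_left hc).mp h)
  have hord : ∀ c ∈ zpowers x, orderOf (c * y) = orderOf x := by
    intro c hc
    have hcx : c ^ orderOf x = 1 := by
      rw [← orderOf_dvd_iff_pow_eq_one]; exact orderOf_dvd_of_mem_zpowers hc
    have hdvd : orderOf (c * y) ∣ orderOf x := by
      rw [orderOf_dvd_iff_pow_eq_one, mul_pow, hcx, ← hy, pow_orderOf_eq_one, one_mul]
    refine (hx.eq_one_or_self_of_dvd _ hdvd).resolve_left fun h => hmem c hc ?_
    rw [orderOf_eq_one_iff.mp h]
    exact one_mem _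
  have hinf : ∀ c ∈ zpowers x, zpowers (c * y) ⊓ zpowers x = ⊥ := fun c hc =>
    zpowers_inf_eq_bot_of_prime_orderOf (by rw [hord c hc]; exact hx) (hmem c hc)
  have hsup : ∀ c ∈ zpowers x, zpowers (c * y) ⊔ zpowers x = zpowers y ⊔ zpowers x := by
    intro c hc
    apply le_antisymm
    · refine sup_le (zpowers_le.mpr ?_) le_sup_right
      exact mul_mem (mem_sup_right hc) (mem_sup_left (mem_zpowers y))
    · refine sup_le (zpowers_le.mpr ?_) le_sup_right
      have h : c⁻¹ * (c * y) ∈ zpowers (c * y) ⊔ zpowers x :=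
        mul_mem (mem_sup_right (inv_mem hc)) (mem_sup_left (mem_zpowers _))
      simpa using h
  rw [← Nat.card_zpowers x]
  symm
  apply Nat.card_eq_of_bijective
    (fun c : zpowers x => (⟨zpowers ((c : A) * y), hinf c c.2, hsup c c.2⟩ :
      {C : Subgroup A // C ⊓ zpowers x = ⊥ ∧ C ⊔ zpowers x = zpowers y ⊔ zpowers x}))
  constructor
  · intro c d hcd
    have hcd' : zpowers ((c : A) * y) = zpowers ((d : A) * y) := congrArg Subtype.val hcd
    have h1 : (c : A) * y / (d * y) ∈ zpowers ((c : A) * y) :=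
      Subgroup.div_mem _ (mem_zpowers _) (by rw [hcd']; exact mem_zpowers _)
    rw [mul_div_mul_right_eq_div] at h1
    have h2 : (c : A) / d ∈ zpowers ((c : A) * y) ⊓ zpowers x := ⟨h1, Subgroup.div_mem _ c.2 d.2⟩
    rw [hinf c c.2, mem_bot, div_eq_one] at h2
    exact Subtype.ext h2
  · rintro ⟨C, hC1, hC2⟩
    have hyC : y ∈ C ⊔ zpowers x := hC2 ▸ mem_sup_left (mem_zpowers y)
    obtain ⟨z, hz, c, hc, hzc⟩ := mem_sup.mp hyC
    refine ⟨⟨c⁻¹, inv_mem hc⟩, Subtype.ext ?_⟩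
    refine eq_of_le_of_inf_le_of_sup_le (z := zpowers x) (zpowers_le.mpr ?_) ?_ ?_
    · have hzy : c⁻¹ * y = z := by rw [← hzc, mul_comm z, inv_mul_cancel_left]
      exact (congrArg (· ∈ C) hzy).mpr hz
    · rw [hC1]; exact bot_le
    · rw [hC2]; exact (hsup _ (inv_mem hc)).ge

theorem eq_zpowers_of_inf_eq_bot_of_sup_eq [Finite A] {x y : A} (hx : (orderOf x).Prime)
    (hy : (orderOf y).Prime) (hxy : orderOf y ≠ orderOf x) {C : Subgroup A}
    (hinf : C ⊓ zpowers x = ⊥) (hsup : C ⊔ zpowers x = zpowers y ⊔ zpowers x) :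
    C = zpowers y := by
  symm
  refine eq_of_le_of_inf_le_of_sup_le (z := zpowers x) (zpowers_le.mpr ?_) ?_ hsup.le
  · have hyC : y ∈ C ⊔ zpowers x := hsup ▸ mem_sup_left (mem_zpowers y)
    obtain ⟨z, hz, c, hc, rfl⟩ := mem_sup.mp hyC
    have hcx : c ^ orderOf x = 1 := by
      rw [← orderOf_dvd_iff_pow_eq_one]; exact orderOf_dvd_of_mem_zpowers hc
    have hpow : (z * c) ^ orderOf x ∈ C := by
      rw [mul_pow, hcx, mul_one]; exact pow_mem hz _
    have hcop : (orderOf (z * c)).Coprime (orderOf x) := (Nat.coprime_primes hy hx).mpr hxy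
    obtain ⟨k, hk⟩ := exists_pow_eq_self_of_coprime hcop.symm
    exact hk ▸ pow_mem hpow k
  · exact hinf.le.trans bot_le

/-- No Sylow subgroup of `A` is nontrivial and cyclic. -/
def NoCyclicSylow (A : Type*) [CommGroup A] : Prop :=
  ∀ x : A, (orderOf x).Prime → ∃ y, orderOf y = orderOf x ∧ y ∉ zpowers x

theorem exists_orderOf_eq_and_map_zpowers_of_prime [Finite A] [Finite B] (hA : NoCyclicSylow A)
    (φ : Subgroup A ≃o Subgroup B) {x : A} (hx : (orderOf x).Prime) :
    ∃ y, φ (zpowers x) = zpowers y ∧ orderOf y = orderOf x := by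
  obtain ⟨x', hx', hxx'⟩ := hA x hx
  obtain ⟨y, hy, hφx⟩ := exists_prime_orderOf_of_isAtom
    ((φ.isAtom_iff _).mpr (isAtom_zpowers_of_prime_orderOf hx))
  obtain ⟨y', hy', hφx'⟩ := exists_prime_orderOf_of_isAtom
    ((φ.isAtom_iff _).mpr (isAtom_zpowers_of_prime_orderOf (x := x') (hx' ▸ hx)))
  refine ⟨y, hφx, ?_⟩
  have hcard : Nat.card {C : Subgroup B // C ⊓ zpowers y = ⊥ ∧
      C ⊔ zpowers y = zpowers y' ⊔ zpowers y} = orderOf x := by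
    rw [← card_compl_zpowers_of_orderOf_eq hx hx' hxx']
    refine (Nat.card_congr (φ.toEquiv.subtypeEquiv fun C => ?_)).symm
    simp only [RelIso.coe_fn_toEquiv, ← hφx, ← hφx', ← φ.map_inf, ← φ.map_sup,
      _root_.map_eq_bot_iff, φ.apply_eq_iff_eq]
  by_cases hyy : orderOf y' = orderOf y
  · rw [← hcard, card_compl_zpowers_of_orderOf_eq hy hyy]
    intro hmem
    refine hxx' ?_
    rw [← zpowers_le, ← φ.le_iff_le, hφx, hφx']
    exact zpowers_le.mpr hmem
  · have : Subsingleton {C : Subgroup B // C ⊓ zpowers y = ⊥ ∧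
        C ⊔ zpowers y = zpowers y' ⊔ zpowers y} :=
      ⟨fun C D => Subtype.ext <|
        (eq_zpowers_of_inf_eq_bot_of_sup_eq hy hy' hyy C.2.1 C.2.2).trans
        (eq_zpowers_of_inf_eq_bot_of_sup_eq hy hy' hyy D.2.1 D.2.2).symm⟩
    exact absurd (hcard ▸ Finite.card_le_one_iff_subsingleton.mpr this) hx.one_lt.not_ge

theorem le_zpowers_pow_of_lt_zpowers {x : A} {p k : ℕ} (hp : p.Prime)
    (hx : orderOf x = p ^ k) {K : Subgroup A} (hK : K < zpowers x) : K ≤ zpowers (x ^ p) := by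
  intro z hz
  obtain ⟨a, rfl⟩ := mem_zpowers_iff.mp (hK.le hz)
  by_cases hpa : (p : ℤ) ∣ a
  · obtain ⟨b, rfl⟩ := hpa
    rw [zpow_mul, zpow_natCast]
    exact zpow_mem (mem_zpowers _) b
  · refine absurd (zpowers_le.mpr ?_) hK.not_ge
    have hcop : IsCoprime a (orderOf x : ℤ) := by
      rw [hx, Nat.cast_pow]
      exact (((Nat.prime_iff_prime_int.mp hp).coprime_iff_not_dvd.mpr hpa).symm).pow_right
    obtain ⟨u, v, huv⟩ := hcop
    have : x = (x ^ a) ^ u := by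
      conv_lhs => rw [← zpow_one x, ← huv, zpow_add, zpow_mul x v, zpow_natCast]
      rw [orderOf_dvd_iff_pow_eq_one.mp (orderOf_dvd_of_mem_zpowers (zpow_mem (mem_zpowers x) v)),
        mul_one, ← zpow_mul, mul_comm u]
    rw [this]
    exact zpow_mem hz u

theorem exists_orderOf_eq_and_map_zpowers [Finite A] [Finite B] (hA : NoCyclicSylow A)
    (φ : Subgroup A ≃o Subgroup B) {p : ℕ} (hp : p.Prime) {k : ℕ} {x : A}
    (hx : orderOf x = p ^ k) :
    ∃ y, φ (zpowers x) = zpowers y ∧ orderOf y = p ^ k := by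
  induction k generalizing x with
  | zero =>
    rw [pow_zero, orderOf_eq_one_iff] at hx
    exact ⟨1, by simp [hx], by simp⟩
  | succ k ih =>
    rcases Nat.eq_zero_or_pos k with rfl | hk
    · rw [zero_add, pow_one] at hx ⊢
      rw [← hx]
      exact exists_orderOf_eq_and_map_zpowers_of_prime hA φ (hx ▸ hp)
    have hxp : orderOf (x ^ p) = p ^ k := by
      rw [orderOf_pow_of_dvd hp.ne_zero (hx ▸ dvd_pow_self p k.succ_ne_zero), hx, pow_succ,
        Nat.mul_div_cancel _ hp.pos]
    obtain ⟨w, hw, hwk⟩ := ih hxp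
    have hlt : zpowers (x ^ p) < zpowers x := by
      refine lt_of_le_of_ne (zpowers_le.mpr (pow_mem (mem_zpowers x) p)) fun h => ?_
      have := congrArg (fun K : Subgroup A => Nat.card K) h
      simp only [Nat.card_zpowers, hx, hxp] at this
      exact (Nat.pow_lt_pow_succ hp.one_lt).ne this
    have hmax : ∀ K < φ (zpowers x), K ≤ zpowers w := by
      intro K hK
      rw [← hw, ← φ.symm_apply_le]
      exact le_zpowers_pow_of_lt_zpowers hp hx (φ.symm_apply_lt.mpr hK)
    have hφlt : zpowers w < φ (zpowers x) := hw ▸ φ.lt_iff_lt.mpr hlt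
    obtain ⟨y, hy, hyw⟩ := SetLike.exists_of_lt hφlt
    have hφx : φ (zpowers x) = zpowers y :=
      (eq_of_le_of_not_lt (zpowers_le.mpr hy) fun h => hyw (zpowers_le.mp (hmax _ h))).symm
    refine ⟨y, hφx, ?_⟩
    rw [hφx] at hφlt hmax
    have hdvd : p ^ k ∣ orderOf y := by
      rw [← hwk]; exact orderOf_dvd_of_mem_zpowers (zpowers_le.mp hφlt.le)
    have hpy : p ∣ orderOf y := (dvd_pow_self p hk.ne').trans hdvd
    have hyp : orderOf (y ^ p) = orderOf y / p := orderOf_pow_of_dvd hp.ne_zero hpy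
    have hylt : zpowers (y ^ p) < zpowers y := by
      refine lt_of_le_of_ne (zpowers_le.mpr (pow_mem (mem_zpowers y) p)) fun h => ?_
      have := congrArg (fun K : Subgroup B => Nat.card K) h
      simp only [Nat.card_zpowers, hyp] at this
      exact (Nat.div_lt_self (orderOf_pos y) hp.one_lt).ne this
    have hydvd : orderOf y ∣ p ^ (k + 1) := by
      have h := orderOf_dvd_of_mem_zpowers (zpowers_le.mp (hmax _ hylt))
      rw [hyp, hwk] at h
      rw [pow_succ]
      exact (Nat.div_dvd_iff_dvd_mul hpy hp.pos).mp h |>.trans (by rw [mul_comm])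
    obtain ⟨j, hj, hyj⟩ := (Nat.dvd_prime_pow hp).mp hydvd
    have hjk : k < j := by
      refine lt_of_le_of_ne ((Nat.pow_dvd_pow_iff_le_right hp.one_lt).mp (hyj ▸ hdvd)) ?_
      rintro rfl
      exact hφlt.ne (eq_of_le_of_card_ge hφlt.le
        (by rw [Nat.card_zpowers, Nat.card_zpowers, hyj, hwk]))
    rw [hyj, le_antisymm hj hjk]

theorem card_pow_eq_one_le [Finite A] [Finite B] (hA : NoCyclicSylow A)
    (φ : Subgroup A ≃o Subgroup B) {p : ℕ} (hp : p.Prime) (k : ℕ) :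
    Nat.card {x : A // x ^ p ^ k = 1} ≤ Nat.card {y : B // y ^ p ^ k = 1} := by
  have key : ∀ K : Subgroup A, (∃ x, x ^ p ^ k = 1 ∧ K = zpowers x) → Nonempty (K ≃* φ K) := by
    rintro _ ⟨x, hx, rfl⟩
    obtain ⟨j, -, hxj⟩ := (Nat.dvd_prime_pow hp).mp (orderOf_dvd_of_pow_eq_one hx)
    obtain ⟨y, hy, hyj⟩ := exists_orderOf_eq_and_map_zpowers hA φ hp hxj
    rw [hy]
    exact ⟨mulEquivOfCyclicCardEq (by rw [Nat.card_zpowers, Nat.card_zpowers, hxj, hyj])⟩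
  let e : ∀ K : Subgroup A, (∃ x, x ^ p ^ k = 1 ∧ K = zpowers x) → (K ≃* φ K) :=
    fun K hK => (key K hK).some
  let f : {x : A // x ^ p ^ k = 1} → B := fun x =>
    e (zpowers x.1) ⟨x, x.2, rfl⟩ ⟨x.1, mem_zpowers x.1⟩
  have hf : ∀ x, zpowers (f x) = φ (zpowers x.1) := by
    intro x
    set E := e (zpowers x.1) ⟨x, x.2, rfl⟩
    refine eq_of_le_of_card_ge (zpowers_le.mpr (E _).2) ?_
    rw [Nat.card_zpowers, ← Nat.card_congr E.toEquiv, Nat.card_zpowers]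
    simp only [f, Subgroup.orderOf_coe]
    rw [MulEquiv.orderOf_eq, ← Subgroup.orderOf_coe]
  have hpow : ∀ x, f x ^ p ^ k = 1 := by
    intro x
    simp only [f]
    rw [← Subgroup.coe_pow, ← map_pow, OneMemClass.coe_eq_one, EmbeddingLike.map_eq_one_iff]
    exact Subtype.ext x.2
  refine Nat.card_le_card_of_injective (fun x => (⟨f x, hpow x⟩ : {y : B // y ^ p ^ k = 1})) ?_
  rintro x x' hxx'
  have hfe : f x = f x' := congrArg Subtype.val hxx'
  have hz : zpowers x.1 = zpowers x'.1 := φ.injective (by rw [← hf, ← hf, hfe])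
  have aux : ∀ (K L : Subgroup A) (hK : ∃ x, x ^ p ^ k = 1 ∧ K = zpowers x)
      (hL : ∃ x, x ^ p ^ k = 1 ∧ L = zpowers x) (a : K) (b : L), K = L →
      (e K hK a : B) = e L hL b → (a : A) = b := by
    rintro K _ hK hL a b rfl hab
    exact congrArg Subtype.val ((e K hK).injective (Subtype.ext hab))
  exact Subtype.ext (aux _ _ ⟨x, x.2, rfl⟩ ⟨x', x'.2, rfl⟩ ⟨x, mem_zpowers x.1⟩
    ⟨x', mem_zpowers x'.1⟩ hz hfe)

theorem card_pow_eq_one_eq [Finite A] [Finite B] (hA : NoCyclicSylow A) (hB : NoCyclicSylow B)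
    (φ : Subgroup A ≃o Subgroup B) {p : ℕ} (hp : p.Prime) (k : ℕ) :
    Nat.card {x : A // x ^ p ^ k = 1} = Nat.card {y : B // y ^ p ^ k = 1} :=
  le_antisymm (card_pow_eq_one_le hA φ hp k) (card_pow_eq_one_le hB φ.symm hp k)

end SubgroupLattice

section HomCounting

instance MonoidHom.finite_of_finite {X G : Type*} [Group X] [Group G] [Finite X] [Finite G] :
    Finite (X →* G) :=
  Finite.of_injective _ DFunLike.coe_injective

/-- A homomorphism from `ZMod n` is determined by an element of order dividing `n`. -/
def zmodHomEquiv (n : ℕ) (K : Type*) [CommGroup K] :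
    (ZMod n →+ Additive K) ≃ {g : K // g ^ n = 1} :=
  (ZMod.lift n (A := Additive K)).symm.trans
    (((zmultiplesHom (Additive K)).symm.trans Additive.toMul).subtypeEquiv fun f => by
      have : f n = n • f 1 := by rw [← map_nsmul, nsmul_one]
      rw [this]
      rfl)

theorem card_monoidHom_eq_of_card_pow_eq_one_eq {X G H : Type*} [CommGroup X] [Finite X]
    [CommGroup G] [CommGroup H] [Finite G] [Finite H]
    (h : ∀ p k : ℕ, p.Prime →
      Nat.card {g : G // g ^ p ^ k = 1} = Nat.card {g : H // g ^ p ^ k = 1}) :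
    Nat.card (X →* G) = Nat.card (X →* H) := by
  classical
  obtain ⟨ι, _, p, hp, e, ⟨E⟩⟩ := AddCommGroup.equiv_directSum_zmod_of_finite (Additive X)
  have hcyc : ∀ i, (ZMod (p i ^ e i) →+ Additive G) ≃ (ZMod (p i ^ e i) →+ Additive H) :=
    fun i => (zmodHomEquiv _ G).trans
      ((Finite.card_eq.mp (h (p i) (e i) (hp i))).some.trans
        (zmodHomEquiv _ H).symm)
  exact Nat.card_congr <| MonoidHom.toAdditive.trans <| E.addMonoidHomCongrLeftEquiv.trans <|
    DFinsupp.liftAddHom.symm.toEquiv.trans <| (Equiv.piCongrRight hcyc).trans <|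
    DFinsupp.liftAddHom.toEquiv.trans <| E.symm.addMonoidHomCongrLeftEquiv.trans
    MonoidHom.toAdditive.symm

/-- Homomorphisms with kernel `K` are the injective homomorphisms from the quotient by `K`. -/
def kerEqEquivInjective {X G : Type*} [CommGroup X] [CommGroup G] (K : Subgroup X) :
    {f : X →* G // f.ker = K} ≃ {f : X ⧸ K →* G // Function.Injective f} where
  toFun f := ⟨QuotientGroup.lift K f.1 f.2.ge, by
    rw [← MonoidHom.ker_eq_bot_iff, QuotientGroup.ker_lift, f.2, QuotientGroup.map_mk'_self]⟩
  invFun f := ⟨f.1.comp (QuotientGroup.mk' K), by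
    rw [MonoidHom.ker_comp_of_injective _ _ f.2, QuotientGroup.ker_mk']⟩
  left_inv f := Subtype.ext (MonoidHom.ext fun x => rfl)
  right_inv f := Subtype.ext (QuotientGroup.monoidHom_ext _ rfl)

theorem card_monoidHom_eq_sum {X G : Type*} [CommGroup X] [Finite X] [CommGroup G] [Finite G]
    [Fintype (Subgroup X)] :
    Nat.card (X →* G) = ∑ K : Subgroup X, Nat.card {f : X ⧸ K →* G // Function.Injective f} := by
  rw [← Nat.card_congr (Equiv.sigmaFiberEquiv fun f : X →* G => f.ker), Nat.card_sigma]
  exact Finset.sum_congr rfl fun K _ => Nat.card_congr (kerEqEquivInjective K)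

theorem card_injective_quotient_bot (X K : Type*) [CommGroup X] [CommGroup K] :
    Nat.card {f : X ⧸ (⊥ : Subgroup X) →* K // Function.Injective f} =
      Nat.card {f : X →* K // Function.Injective f} := by
  rw [← Nat.card_congr (kerEqEquivInjective ⊥)]
  exact Nat.card_congr (Equiv.subtypeEquivRight fun f => MonoidHom.ker_eq_bot_iff f)

theorem card_injective_monoidHom_eq {G : Type*} {H : Type*} [CommGroup G] [CommGroup H]
    [Finite G] [Finite H]
    (h : ∀ p k : ℕ, p.Prime →
      Nat.card {g : G // g ^ p ^ k = 1} = Nat.card {g : H // g ^ p ^ k = 1})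
    (X : Type*) [CommGroup X] [Finite X] :
    Nat.card {f : X →* G // Function.Injective f} =
      Nat.card {f : X →* H // Function.Injective f} := by
  classical
  induction hN : Nat.card X using Nat.strong_induction_on generalizing X with
  | _ N ih =>
  subst hN
  have := Fintype.ofFinite (Subgroup X)
  have hsum := card_monoidHom_eq_of_card_pow_eq_one_eq (X := X) h
  rw [card_monoidHom_eq_sum, card_monoidHom_eq_sum,
    ← Finset.add_sum_erase _ _ (Finset.mem_univ ⊥),
    ← Finset.add_sum_erase _ _ (Finset.mem_univ ⊥)] at hsum
  have hrest : ∀ K ∈ Finset.univ.erase (⊥ : Subgroup X),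
      Nat.card {f : X ⧸ K →* G // Function.Injective f} =
        Nat.card {f : X ⧸ K →* H // Function.Injective f} := by
    intro K hK
    refine ih _ ?_ (X ⧸ K) rfl
    rw [Subgroup.card_eq_card_quotient_mul_card_subgroup K]
    exact lt_mul_of_one_lt_right Nat.card_pos (Subgroup.one_lt_card_iff_ne_bot K |>.mpr
      (Finset.ne_of_mem_erase hK))
  rw [Finset.sum_congr rfl hrest] at hsum
  have := Nat.add_right_cancel hsum
  rwa [card_injective_quotient_bot, card_injective_quotient_bot] at this

theorem exists_injective_monoidHom {G H : Type*} [CommGroup G] [CommGroup H] [Finite G] [Finite H]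
    (h : ∀ p k : ℕ, p.Prime →
      Nat.card {g : G // g ^ p ^ k = 1} = Nat.card {g : H // g ^ p ^ k = 1}) :
    ∃ f : G →* H, Function.Injective f := by
  have : Nonempty {f : G →* G // Function.Injective f} :=
    ⟨⟨MonoidHom.id G, Function.injective_id⟩⟩
  have hpos : 0 < Nat.card {f : G →* H // Function.Injective f} :=
    card_injective_monoidHom_eq h G ▸ Nat.card_pos
  obtain ⟨f⟩ := (Nat.card_pos_iff.mp hpos).1
  exact ⟨f, f.2⟩

theorem nonempty_mulEquiv_of_card_pow_eq_one_eq {G H : Type*} [CommGroup G] [CommGroup H]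
    [Finite G] [Finite H]
    (h : ∀ p k : ℕ, p.Prime →
      Nat.card {g : G // g ^ p ^ k = 1} = Nat.card {g : H // g ^ p ^ k = 1}) :
    Nonempty (G ≃* H) := by
  obtain ⟨f, hf⟩ := exists_injective_monoidHom h
  obtain ⟨g, hg⟩ := exists_injective_monoidHom fun p k hp => (h p k hp).symm
  have hcard : Nat.card G = Nat.card H :=
    le_antisymm (Nat.card_le_card_of_injective f hf) (Nat.card_le_card_of_injective g hg)
  exact ⟨MulEquiv.ofBijective f ((Nat.bijective_iff_injective_and_card f).mpr ⟨hf, hcard⟩)⟩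

end HomCounting

section Powers

theorem noCyclicSylow_pi {G : Type*} [CommGroup G] [Finite G] {m : ℕ} (hm : 2 ≤ m) :
    NoCyclicSylow (Fin m → G) := by
  intro x hx
  obtain ⟨i, hi⟩ : ∃ i, x i ≠ 1 := by
    by_contra! hcon
    exact hx.ne_one (orderOf_eq_one_iff.mpr (funext hcon))
  have hxi : orderOf (x i) = orderOf x := by
    refine (hx.eq_one_or_self_of_dvd _ ?_).resolve_left (by rwa [orderOf_eq_one_iff])
    rw [orderOf_dvd_iff_pow_eq_one, ← Pi.pow_apply, pow_orderOf_eq_one, Pi.one_apply]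
  have hsingle : ∀ j, orderOf (Pi.mulSingle j (x i) : Fin m → G) = orderOf x := fun j => by
    rw [← hxi]
    exact orderOf_injective (MonoidHom.mulSingle (fun _ : Fin m => G) j)
      (Pi.mulSingle_injective (M := fun _ : Fin m => G) j) (x i)
  have : Nontrivial (Fin m) := Fin.nontrivial_iff_two_le.mpr hm
  obtain ⟨j, hj⟩ := exists_ne i
  by_contra! hcon
  have h1 := hcon _ (hsingle i)
  have h2 := hcon _ (hsingle j)
  have h3 : (Pi.mulSingle j (x i) : Fin m → G) ∈ zpowers (Pi.mulSingle i (x i) : Fin m → G) := by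
    have : zpowers (Pi.mulSingle i (x i) : Fin m → G) = zpowers x := by
      rcases ((isAtom_zpowers_of_prime_orderOf hx).le_iff.mp (zpowers_le.mpr h1)) with h | h
      · rw [zpowers_eq_bot, Pi.mulSingle_eq_one_iff] at h
        exact absurd h hi
      · exact h
    rwa [this]
  obtain ⟨a, ha⟩ := mem_zpowers_iff.mp h3
  have := congrFun ha j
  rw [Pi.pow_apply, Pi.mulSingle_eq_of_ne hj, one_zpow, Pi.mulSingle_eq_same] at this
  exact hi this.symm

theorem card_pi_pow_eq_one (G : Type*) [CommGroup G] (m n : ℕ) :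
    Nat.card {x : Fin m → G // x ^ n = 1} = Nat.card {g : G // g ^ n = 1} ^ m := by
  rw [← Nat.card_fin m, ← Nat.card_fun, Nat.card_fin]
  refine Nat.card_congr ((Equiv.subtypeEquivRight fun x => ?_).trans
    (Equiv.subtypePiEquivPi (p := fun (_ : Fin m) (g : G) => g ^ n = 1)))
  exact funext_iff

theorem eq_of_forall_pow_eq_pow_of_gcd_eq {r : ℕ} (hr : 1 ≤ r) {m n : Fin r → ℕ}
    (hm : ∀ i, m i ≠ 0) (hn : ∀ i, n i ≠ 0) (hgcd : Finset.univ.gcd m = Finset.univ.gcd n) {a b : ℕ}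
    (ha : 1 ≤ a) (h : ∀ i, a ^ m i = b ^ n i) : a = b := by
  let j : Fin r := ⟨0, hr⟩
  rcases ha.eq_or_lt with rfl | ha
  · have := h j
    rw [one_pow, eq_comm, Nat.pow_eq_one, or_iff_left (hn j)] at this
    exact this.symm
  have hcross : ∀ i, m i * n j = n i * m j := by
    intro i
    apply Nat.pow_right_injective ha
    simp only
    rw [pow_mul, h i, mul_comm (n i), pow_mul, h j, ← pow_mul, ← pow_mul, mul_comm]
  have hg : Finset.univ.gcd m * n j = Finset.univ.gcd n * m j := by
    have := congrArg (Finset.univ.gcd) (funext hcross)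
    simpa [Finset.gcd_mul_right] using this
  have hne : Finset.univ.gcd n ≠ 0 := fun h0 =>
    hn j (Finset.gcd_eq_zero_iff.mp h0 j (Finset.mem_univ j))
  rw [hgcd] at hg
  have hmn : n j = m j := Nat.eq_of_mul_eq_mul_left (Nat.pos_of_ne_zero hne) hg
  have := h j
  rw [hmn] at this
  exact Nat.pow_left_injective (hm j) this

end Powers


/-- **Theorem 3** (Tărnăuceanu). Finite abelian groups `G` and `H` are isomorphic iff
there are `r ≥ 1` and integers `m₁, …, m_r, n₁, …, n_r ≥ 2` with
`gcd(m₁, …, m_r) = gcd(n₁, …, n_r)` and `L(G^{mᵢ}) ≅ L(H^{nᵢ})` for all `i`. -/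
theorem thm3_gcd_powers_iff
    (G H : Type*) [CommGroup G] [Finite G] [CommGroup H] [Finite H] :
    Nonempty (G ≃* H) ↔
      ∃ (r : ℕ), 1 ≤ r ∧ ∃ (m n : Fin r → ℕ),
        (∀ i, 2 ≤ m i) ∧ (∀ i, 2 ≤ n i) ∧
        Finset.univ.gcd m = Finset.univ.gcd n ∧
        ∀ i, Nonempty (Subgroup (Fin (m i) → G) ≃o Subgroup (Fin (n i) → H)) := by
  constructor
  · rintro ⟨e⟩
    refine ⟨1, le_rfl, fun _ => 2, fun _ => 2, fun _ => le_rfl, fun _ => le_rfl, rfl, fun _ => ?_⟩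
    exact ⟨(MulEquiv.piCongrRight fun _ => e).mapSubgroup⟩
  · rintro ⟨r, hr, m, n, hm, hn, hgcd, hφ⟩
    refine nonempty_mulEquiv_of_card_pow_eq_one_eq fun p k hp => ?_
    have : Nonempty {g : G // g ^ p ^ k = 1} := ⟨⟨1, one_pow _⟩⟩
    refine eq_of_forall_pow_eq_pow_of_gcd_eq hr (fun i => (two_pos.trans_le (hm i)).ne')
      (fun i => (two_pos.trans_le (hn i)).ne') hgcd Nat.card_pos fun i => ?_
    obtain ⟨φ⟩ := hφ i
    rw [← card_pi_pow_eq_one, ← card_pi_pow_eq_one]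
    exact card_pow_eq_one_eq (noCyclicSylow_pi (hm i)) (noCyclicSylow_pi (hn i)) φ hp k
end

section
/- Let G and H be finite abelian groups with invariant factor decompositions G ≅ ℤ/d₁ × ... × ℤ/d_k (with 2 ≤ d₁, d₁ | d₂ | ... | d_k) and H ≅ ℤ/d'₁ × ... × ℤ/d'_{k'} (with 2 ≤ d'₁, d'₁ | d'₂ | ... | d'_{k'}), and let m, n ≥ 2 be integers. If the subgroup lattice of G^m is isomorphic (as an order/lattice) to the subgroup lattice of H^n, then k·m = k'·n; that is, the number of invariant factors of G times m equals the number of invariant factors of H times n. -/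
/-- An element of a lattice below which meets distribute over joins. -/
def IsLocallyDistributive {L : Type*} [Lattice L] (x : L) : Prop :=
  ∀ a b c : L, a ≤ x → b ≤ x → c ≤ x → a ⊓ (b ⊔ c) ≤ (a ⊓ b) ⊔ (a ⊓ c)

theorem IsLocallyDistributive.map_orderIso {L M : Type*} [Lattice L] [Lattice M] {x : L}
    (hx : IsLocallyDistributive x) (e : L ≃o M) : IsLocallyDistributive (e x) := by
  intro a b c ha hb hc
  have h := hx (e.symm a) (e.symm b) (e.symm c) (e.symm_apply_le.2 ha) (e.symm_apply_le.2 hb)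
    (e.symm_apply_le.2 hc)
  simpa only [← map_sup, ← map_inf, OrderIso.le_iff_le] using h

/-- Cyclic subgroups of a commutative group have a distributive subgroup lattice. -/
theorem isLocallyDistributive_zpowers {A : Type*} [CommGroup A] (g : A) :
    IsLocallyDistributive (Subgroup.zpowers g) := by
  rintro a b c - hb hc z ⟨hza, hzbc⟩
  obtain ⟨y₁, hy₁, y₂, hy₂, rfl⟩ := Subgroup.mem_sup.1 hzbc
  obtain ⟨β, hβ⟩ := Subgroup.mem_zpowers_iff.1 (hb hy₁)
  obtain ⟨γ, hγ⟩ := Subgroup.mem_zpowers_iff.1 (hc hy₂)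
  obtain ⟨r, s, t, u, v, rfl, rfl, huv⟩ :
      ∃ r s t u v : ℤ, β = r * t ∧ γ = s * t ∧ u * r + v * s = 1 := by
    rcases Nat.eq_zero_or_pos (Int.gcd β γ) with h0 | h0
    · obtain ⟨rfl, rfl⟩ := Int.gcd_eq_zero_iff.1 h0
      exact ⟨1, 0, 0, 1, 0, by simp⟩
    · obtain ⟨r, s, hrs, hr, hs⟩ := Int.exists_gcd_one h0
      obtain ⟨u, v, huv⟩ := Int.isCoprime_iff_gcd_eq_one.2 hrs
      exact ⟨r, s, _, u, v, hr, hs, huv⟩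
  have h₁ : (y₁ * y₂) ^ (u * r) = y₁ ^ (u * (r + s)) := by
    rw [← hβ, ← hγ, ← zpow_add, ← zpow_mul, ← zpow_mul]
    congr 1
    ring
  have h₂ : (y₁ * y₂) ^ (v * s) = y₂ ^ (v * (r + s)) := by
    rw [← hβ, ← hγ, ← zpow_add, ← zpow_mul, ← zpow_mul]
    congr 1
    ring
  rw [← zpow_one (y₁ * y₂), ← huv, zpow_add]
  exact Subgroup.mul_mem_sup
    ⟨a.zpow_mem hza _, by rw [h₁]; exact b.zpow_mem hy₁ _⟩
    ⟨a.zpow_mem hza _, by rw [h₂]; exact c.zpow_mem hy₂ _⟩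

/-- The image of a locally distributive subgroup in a vector space over a prime field spans at
most a line. -/
theorem IsLocallyDistributive.exists_map_mem_span {A V : Type*} [CommGroup A] {p : ℕ}
    [Fact p.Prime] [AddCommGroup V] [Module (ZMod p) V] (f : A →* Multiplicative V)
    {D : Subgroup A} (hD : IsLocallyDistributive D) :
    ∃ v : V, ∀ y ∈ D, (f y).toAdd ∈ Submodule.span (ZMod p) {v} := by
  by_cases h0 : ∀ y ∈ D, (f y).toAdd = 0
  · exact ⟨0, fun y hy => by simp [h0 y hy]⟩
  push Not at h0
  obtain ⟨x, hxD, hx⟩ := h0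
  refine ⟨(f x).toAdd, fun y hy => ?_⟩
  by_contra hxy
  set v := (f x).toAdd with hv
  set w := (f y).toAdd with hw
  have hind : LinearIndependent (ZMod p) ![v, w] := by
    rw [LinearIndependent.pair_iff' hx]
    intro a ha
    exact hxy (Submodule.mem_span_singleton.2 ⟨a, ha⟩)
  have hpair := LinearIndependent.pair_iff.1 hind
  let W (z : V) : Subgroup A :=
    ((Submodule.span (ZMod p) {z}).toAddSubgroup.toSubgroup.comap f) ⊓ D
  have hW (z : V) (g : A) : g ∈ W z ↔ (∃ c : ZMod p, c • z = (f g).toAdd) ∧ g ∈ D := by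
    rw [← Submodule.mem_span_singleton]; rfl
  have hmem : x * y ∈ W (v + w) ⊓ (W v ⊔ W w) := by
    refine ⟨(hW _ _).2 ⟨⟨1, by simp [hv, hw]⟩, D.mul_mem hxD hy⟩,
      Subgroup.mul_mem_sup ((hW _ _).2 ⟨⟨1, by simp [hv]⟩, hxD⟩)
        ((hW _ _).2 ⟨⟨1, by simp [hw]⟩, hy⟩)⟩
  have hker : (W (v + w) ⊓ W v) ⊔ (W (v + w) ⊓ W w) ≤ f.ker := by
    refine sup_le ?_ ?_
    · rintro g ⟨h₁, h₂⟩
      obtain ⟨⟨a, ha⟩, -⟩ := (hW _ _).1 h₁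
      obtain ⟨⟨b, hb⟩, -⟩ := (hW _ _).1 h₂
      have := (hpair (a - b) a (by rw [sub_smul, hb, ← ha, smul_add]; abel)).2
      rw [MonoidHom.mem_ker, ← toAdd_eq_zero, ← ha, this, zero_smul]
    · rintro g ⟨h₁, h₂⟩
      obtain ⟨⟨a, ha⟩, -⟩ := (hW _ _).1 h₁
      obtain ⟨⟨b, hb⟩, -⟩ := (hW _ _).1 h₂
      have := (hpair a (a - b) (by rw [sub_smul, hb, ← ha, smul_add]; abel)).1
      rw [MonoidHom.mem_ker, ← toAdd_eq_zero, ← ha, this, zero_smul]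
  have h1 := hker (hD _ _ _ inf_le_right inf_le_right inf_le_right hmem)
  rw [MonoidHom.mem_ker, ← toAdd_eq_zero, map_mul, toAdd_mul] at h1
  exact one_ne_zero (hpair 1 1 (by rw [one_smul, one_smul]; exact h1)).1

/-- A lattice whose top element is a join of locally distributive elements indexed by `ι`. -/
def IsLocallyDistributiveSpanned (ι L : Type*) [CompleteLattice L] : Prop :=
  ∃ x : ι → L, (∀ i, IsLocallyDistributive (x i)) ∧ ⨆ i, x i = ⊤

theorem IsLocallyDistributiveSpanned.map_orderIso {ι L M : Type*} [CompleteLattice L]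
    [CompleteLattice M] (h : IsLocallyDistributiveSpanned ι L) (e : L ≃o M) :
    IsLocallyDistributiveSpanned ι M := by
  obtain ⟨x, hx, htop⟩ := h
  exact ⟨fun i => e (x i), fun i => (hx i).map_orderIso e, by
    rw [← e.map_iSup, htop, e.map_top]⟩

theorem IsLocallyDistributiveSpanned.finrank_le {ι A V : Type*} [Fintype ι] [CommGroup A] {p : ℕ}
    [Fact p.Prime] [AddCommGroup V] [Module (ZMod p) V]
    (h : IsLocallyDistributiveSpanned ι (Subgroup A)) (f : A →* Multiplicative V)
    (hf : Function.Surjective f) : Module.finrank (ZMod p) V ≤ Fintype.card ι := by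
  obtain ⟨x, hx, htop⟩ := h
  choose v hv using fun i => (hx i).exists_map_mem_span (p := p) f
  have hspan : Submodule.span (ZMod p) (Set.range v) = ⊤ := by
    have hle : ⨆ i, x i ≤ (Submodule.span (ZMod p) (Set.range v)).toAddSubgroup.toSubgroup.comap f :=
      iSup_le fun i y hy => Submodule.span_mono (by simp) (hv i y hy)
    rw [htop] at hle
    refine eq_top_iff.2 fun z _ => ?_
    obtain ⟨y, hy⟩ := hf (Multiplicative.ofAdd z)
    have : (f y).toAdd ∈ Submodule.span (ZMod p) (Set.range v) := hle (Subgroup.mem_top y)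
    rwa [hy] at this
  rw [← finrank_top, ← hspan]
  exact finrank_range_le_card v

theorem isLocallyDistributiveSpanned_pi_pi_zmod {ι κ : Type*} [Finite ι] [Finite κ] (d : κ → ℕ) :
    IsLocallyDistributiveSpanned (ι × κ)
      (Subgroup (ι → ∀ i, Multiplicative (ZMod (d i)))) := by
  classical
  cases nonempty_fintype ι
  cases nonempty_fintype κ
  let g (j : ι × κ) : ι → ∀ i, Multiplicative (ZMod (d i)) :=
    Pi.mulSingle j.1 (Pi.mulSingle j.2 (Multiplicative.ofAdd 1))
  refine ⟨fun j => Subgroup.zpowers (g j), fun j => isLocallyDistributive_zpowers _,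
    eq_top_iff.2 fun y _ => ?_⟩
  rw [← Finset.univ_prod_mulSingle y]
  refine Subgroup.prod_mem _ fun l _ => ?_
  rw [← Finset.univ_prod_mulSingle (y l), ← MonoidHom.mulSingle_apply, map_prod]
  refine Subgroup.prod_mem _ fun i _ => ?_
  refine Subgroup.mem_iSup_of_mem (l, i) ?_
  obtain ⟨c, hc⟩ := ZMod.intCast_surjective (y l i).toAdd
  refine Subgroup.mem_zpowers_iff.2 ⟨c, ?_⟩
  have : y l i = Multiplicative.ofAdd (1 : ZMod (d i)) ^ c := by
    rw [← ofAdd_zsmul, zsmul_one, hc, ofAdd_toAdd]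
  rw [this, Pi.mulSingle_zpow, map_zpow]
  rfl

theorem IsLocallyDistributiveSpanned.mul_le_card {ι α : Type*} [Fintype ι] [Fintype α] {k : ℕ}
    {d : Fin k → ℕ} (hd2 : ∀ i, 2 ≤ d i) (hdvd : ∀ i j : Fin k, i ≤ j → d i ∣ d j)
    (h : IsLocallyDistributiveSpanned ι
      (Subgroup (α → ∀ i, Multiplicative (ZMod (d i))))) :
    Fintype.card α * k ≤ Fintype.card ι := by
  rcases Nat.eq_zero_or_pos k with rfl | hk
  · simp
  have : NeZero k := ⟨hk.ne'⟩
  let p := (d 0).minFac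
  have : Fact p.Prime := ⟨Nat.minFac_prime (by have := hd2 0; omega)⟩
  have hp (i : Fin k) : p ∣ d i := (Nat.minFac_dvd _).trans (hdvd 0 i (Fin.zero_le i))
  let f : (α → ∀ i, Multiplicative (ZMod (d i))) →* Multiplicative (α × Fin k → ZMod p) :=
    { toFun := fun y => Multiplicative.ofAdd fun j =>
        ZMod.castHom (hp j.2) (ZMod p) (y j.1 j.2).toAdd
      map_one' := by
        rw [← toAdd_eq_zero]
        funext j
        exact map_zero (ZMod.castHom (hp j.2) (ZMod p))
      map_mul' := fun y z => by
        rw [← ofAdd_add]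
        congr 1
        funext j
        exact map_add (ZMod.castHom (hp j.2) (ZMod p)) _ _ }
  have hf : Function.Surjective f := fun z => by
    choose y hy using fun j : α × Fin k =>
      ZMod.castHom_surjective (hp j.2) (z.toAdd j)
    exact ⟨fun a i => Multiplicative.ofAdd (y (a, i)), congrArg Multiplicative.ofAdd (funext hy)⟩
  simpa using h.finrank_le (p := p) f hf

theorem mul_le_mul_of_subgroup_pi_orderIso {G H : Type*} [CommGroup G] [CommGroup H]
    {k k' m n : ℕ} {d : Fin k → ℕ} {d' : Fin k' → ℕ}
    (hd2 : ∀ i, 2 ≤ d i) (hdvd : ∀ i j : Fin k, i ≤ j → d i ∣ d j)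
    (eG : G ≃* (∀ i : Fin k, Multiplicative (ZMod (d i))))
    (eH : H ≃* (∀ i : Fin k', Multiplicative (ZMod (d' i))))
    (e : Subgroup (Fin m → G) ≃o Subgroup (Fin n → H)) :
    k * m ≤ k' * n := by
  let e' := ((MulEquiv.piCongrRight fun _ : Fin n => eH).mapSubgroup.symm.trans e.symm).trans
    (MulEquiv.piCongrRight fun _ : Fin m => eG).mapSubgroup
  have h := ((isLocallyDistributiveSpanned_pi_pi_zmod (ι := Fin n) d').map_orderIso e').mul_le_card
    hd2 hdvd
  simpa [mul_comm] using h


/-- If `G` and `H` are finite abelian groups with invariant factor decompositions of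
lengths `k` and `k'` respectively, `m, n ≥ 2`, and `L(G^m) ≅ L(H^n)`, then
`k·m = k'·n`. -/
theorem rank_times_power_eq
    (G H : Type*) [CommGroup G] [Finite G] [CommGroup H] [Finite H]
    (k k' : ℕ) (d : Fin k → ℕ) (d' : Fin k' → ℕ)
    (hd2 : ∀ i, 2 ≤ d i) (hd'2 : ∀ i, 2 ≤ d' i)
    (hdvd : ∀ i j : Fin k, i ≤ j → d i ∣ d j)
    (hd'vd : ∀ i j : Fin k', i ≤ j → d' i ∣ d' j)
    (hdecG : Nonempty (G ≃* (∀ i : Fin k, Multiplicative (ZMod (d i)))))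
    (hdecH : Nonempty (H ≃* (∀ i : Fin k', Multiplicative (ZMod (d' i)))))
    (m n : ℕ) (hm : 2 ≤ m) (hn : 2 ≤ n)
    (h : Nonempty (Subgroup (Fin m → G) ≃o Subgroup (Fin n → H))) :
    k * m = k' * n := by
  obtain ⟨eG⟩ := hdecG
  obtain ⟨eH⟩ := hdecH
  obtain ⟨e⟩ := h
  exact le_antisymm (mul_le_mul_of_subgroup_pi_orderIso hd2 hdvd eG eH e)
    (mul_le_mul_of_subgroup_pi_orderIso hd'2 hd'vd eH eG e.symm)
end
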